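/- Suppose the nominal matrices W̄(t), Λ̄(t) are such that there exist ε, w ∈ (0,1) and an integer p ≥ 1 with every interval [t, t+p) being (ε,w)-defected (a semi-periodic defected network). Let P(t) := Λ̄(t)W̄(t) + E(t) be a perturbation with ‖E(t)‖ ≤ ζ for all t, where ζ < −(1/p)·(1 − ε w^p)^{p + 1/p}·ln(1 − ε w^p). Then the perturbed transition matrices Φ_P(t,τ) := P(t−1)⋯P(τ) (with Φ_P(τ,τ) = I) are exponentially stable: there exist c' > 0 and γ' ∈ (0,1) such that ‖Φ_P(t,τ)‖ ≤ c'·γ'^{t−τ} for all t ≥ τ ≥ 0. -/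

import Mathlib

open Matrix Finset Filter

noncomputable section

/-- Maximum absolute row-sum norm of a matrix. -/
noncomputable def rowNorm {n : ℕ} (A : Matrix (Fin n) (Fin n) ℝ) : ℝ :=
  ⨆ i, ∑ j, |A i j|

/-- Auxiliary product: `PhiGenAux A τ k = A(τ+k−1) ⋯ A(τ)`. -/
noncomputable def PhiGenAux {n : ℕ} (A : ℕ → Matrix (Fin n) (Fin n) ℝ) (τ : ℕ) :
    ℕ → Matrix (Fin n) (Fin n) ℝ
  | 0 => 1
  | k + 1 => A (τ + k) * PhiGenAux A τ k

/-- State-transition matrix `Φ_A(t,τ) = A(t−1) ⋯ A(τ)`, `Φ_A(τ,τ) = I`. -/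
noncomputable def PhiGen {n : ℕ} (A : ℕ → Matrix (Fin n) (Fin n) ℝ) (t τ : ℕ) :
    Matrix (Fin n) (Fin n) ℝ :=
  PhiGenAux A τ (t - τ)

/-- The interval `[t0, td)` is `(ε,w)`-defected: every agent `i` is reached by an
influential temporal path from an `ε`-stubborn source. -/
def IsDefected {n : ℕ} (lam : ℕ → Fin n → ℝ) (W : ℕ → Matrix (Fin n) (Fin n) ℝ)
    (ε w : ℝ) (t0 td : ℕ) : Prop :=
  ∀ i : Fin n, ∃ τ : ℕ, t0 ≤ τ ∧ τ < td ∧ ∃ a : ℕ → Fin n, a td = i ∧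
    lam τ (a (τ + 1)) ≤ 1 - ε ∧
    ∀ k, τ + 1 ≤ k → k + 1 ≤ td → w ≤ W k (a (k + 1)) (a k)

section RowNorm

open scoped Matrix.Norms.Operator

variable {n : ℕ}

theorem rowNorm_le_of_forall {A : Matrix (Fin n) (Fin n) ℝ} {c : ℝ} (hn : 1 ≤ n)
    (h : ∀ i, ∑ j, |A i j| ≤ c) : rowNorm A ≤ c :=
  haveI : Nonempty (Fin n) := ⟨⟨0, hn⟩⟩
  ciSup_le h

theorem sum_abs_le_rowNorm (A : Matrix (Fin n) (Fin n) ℝ) (i : Fin n) :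
    ∑ j, |A i j| ≤ rowNorm A :=
  le_ciSup (f := fun i => ∑ j, |A i j|) (Set.finite_range _).bddAbove i

theorem rowNorm_nonneg (A : Matrix (Fin n) (Fin n) ℝ) : 0 ≤ rowNorm A :=
  Real.iSup_nonneg fun _ => Finset.sum_nonneg fun _ _ => abs_nonneg _

theorem rowNorm_eq_norm (A : Matrix (Fin n) (Fin n) ℝ) : rowNorm A = ‖A‖ := by
  rw [Matrix.linfty_opNorm_def]
  apply le_antisymm
  · refine Real.iSup_le (fun i => ?_) (NNReal.coe_nonneg _)
    have h := Finset.le_sup (f := fun i => ∑ j, ‖A i j‖₊) (Finset.mem_univ i)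
    have h' := NNReal.coe_le_coe.2 h
    simpa using h'
  · rw [← NNReal.coe_mk _ (rowNorm_nonneg A), NNReal.coe_le_coe]
    refine Finset.sup_le fun i _ => ?_
    rw [← NNReal.coe_le_coe]
    simpa using sum_abs_le_rowNorm A i

theorem rowNorm_mul_le (A B : Matrix (Fin n) (Fin n) ℝ) :
    rowNorm (A * B) ≤ rowNorm A * rowNorm B := by
  simpa only [rowNorm_eq_norm] using norm_mul_le A B

theorem rowNorm_add_le (A B : Matrix (Fin n) (Fin n) ℝ) :
    rowNorm (A + B) ≤ rowNorm A + rowNorm B := by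
  simpa only [rowNorm_eq_norm] using norm_add_le A B

theorem rowNorm_sum_le {ι : Type*} (s : Finset ι) (f : ι → Matrix (Fin n) (Fin n) ℝ) :
    rowNorm (∑ k ∈ s, f k) ≤ ∑ k ∈ s, rowNorm (f k) := by
  simpa only [rowNorm_eq_norm] using norm_sum_le s f

end RowNorm

section Transition

variable {n : ℕ}

theorem PhiGenAux_add (A : ℕ → Matrix (Fin n) (Fin n) ℝ) (τ k m : ℕ) :
    PhiGenAux A τ (k + m) = PhiGenAux A (τ + k) m * PhiGenAux A τ k := by
  induction m with
  | zero => simp [PhiGenAux]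
  | succ m ih =>
    rw [← Nat.add_assoc, PhiGenAux, ih, PhiGenAux, Matrix.mul_assoc, Nat.add_assoc]

/-- Variation-of-constants formula for the transition matrices of `A + E`. -/
theorem PhiGenAux_add_perturbation (A E : ℕ → Matrix (Fin n) (Fin n) ℝ) (τ m : ℕ) :
    PhiGenAux (fun k => A k + E k) τ m = PhiGenAux A τ m +
      ∑ k ∈ Finset.range m, PhiGenAux A (τ + k + 1) (m - 1 - k) *
        (E (τ + k) * PhiGenAux (fun k => A k + E k) τ k) := by
  induction m with
  | zero => simp [PhiGenAux]
  | succ m ih =>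
    have hstep : ∀ k ∈ Finset.range m,
        PhiGenAux A (τ + k + 1) (m + 1 - 1 - k) =
          A (τ + m) * PhiGenAux A (τ + k + 1) (m - 1 - k) := by
      intro k hk
      have hk := Finset.mem_range.1 hk
      rw [show m + 1 - 1 - k = (m - 1 - k) + 1 by omega, PhiGenAux,
        show τ + k + 1 + (m - 1 - k) = τ + m by omega]
    rw [Finset.sum_range_succ, Finset.sum_congr rfl fun k hk => by rw [hstep k hk]]
    have hlast : PhiGenAux A (τ + m + 1) (m + 1 - 1 - m) = 1 := by simp [PhiGenAux]
    rw [hlast, one_mul, PhiGenAux, add_mul, PhiGenAux]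
    nth_rewrite 1 [ih]
    simp only [mul_add, Finset.mul_sum, Matrix.mul_assoc, add_assoc]

/-- Discrete Grönwall bound: a uniformly exponentially bounded system stays so, with rate
`γ + c * ζ`, under perturbations of norm at most `ζ`. -/
theorem rowNorm_PhiGenAux_perturbation_le {A E : ℕ → Matrix (Fin n) (Fin n) ℝ} {c γ ζ : ℝ}
    (hc : 0 ≤ c) (hγ : 0 ≤ γ) (hζ : 0 ≤ ζ)
    (hA : ∀ τ m, rowNorm (PhiGenAux A τ m) ≤ c * γ ^ m) (hE : ∀ t, rowNorm (E t) ≤ ζ)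
    (τ m : ℕ) :
    rowNorm (PhiGenAux (fun k => A k + E k) τ m) ≤ c * (γ + c * ζ) ^ m := by
  induction m using Nat.strong_induction_on with
  | _ m ih =>
    have hterm : ∀ k ∈ Finset.range m,
        rowNorm (PhiGenAux A (τ + k + 1) (m - 1 - k) *
          (E (τ + k) * PhiGenAux (fun k => A k + E k) τ k)) ≤
        c * (c * ζ) * ((γ + c * ζ) ^ k * γ ^ (m - 1 - k)) := by
      intro k hk
      calc _ ≤ rowNorm (PhiGenAux A (τ + k + 1) (m - 1 - k)) *
            (rowNorm (E (τ + k)) * rowNorm (PhiGenAux (fun k => A k + E k) τ k)) :=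
            (rowNorm_mul_le _ _).trans
              (mul_le_mul_of_nonneg_left (rowNorm_mul_le _ _) (rowNorm_nonneg _))
        _ ≤ (c * γ ^ (m - 1 - k)) * (ζ * (c * (γ + c * ζ) ^ k)) := by
            refine mul_le_mul (hA _ _) ?_
              (mul_nonneg (rowNorm_nonneg _) (rowNorm_nonneg _)) (by positivity)
            exact mul_le_mul (hE _) (ih k (Finset.mem_range.1 hk)) (rowNorm_nonneg _) hζ
        _ = _ := by ring
    rw [PhiGenAux_add_perturbation]
    have hgeom := (Commute.all (γ + c * ζ) γ).geom_sum₂_mul m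
    calc _ ≤ c * γ ^ m + ∑ k ∈ Finset.range m,
          c * (c * ζ) * ((γ + c * ζ) ^ k * γ ^ (m - 1 - k)) :=
          (rowNorm_add_le _ _).trans
            (add_le_add (hA τ m) ((rowNorm_sum_le _ _).trans (Finset.sum_le_sum hterm)))
      _ = c * (γ + c * ζ) ^ m := by
          rw [← Finset.mul_sum]
          linear_combination c * hgeom

end Transition

section Defected

variable {n : ℕ} {lam : ℕ → Fin n → ℝ} {W : ℕ → Matrix (Fin n) (Fin n) ℝ}

theorem PhiGenAux_nonneg (hW0 : ∀ t i j, 0 ≤ W t i j)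
    (hlam : ∀ t i, 0 ≤ lam t i ∧ lam t i ≤ 1) (τ m : ℕ) (i j : Fin n) :
    0 ≤ PhiGenAux (fun k => Matrix.diagonal (lam k) * W k) τ m i j := by
  induction m generalizing i with
  | zero =>
    rw [PhiGenAux, Matrix.one_apply]
    split_ifs <;> norm_num
  | succ m ih =>
    rw [PhiGenAux, Matrix.mul_apply]
    refine Finset.sum_nonneg fun l _ => mul_nonneg ?_ (ih l)
    rw [Matrix.diagonal_mul]
    exact mul_nonneg (hlam _ _).1 (hW0 _ _ _)

theorem sum_PhiGenAux_succ (τ m : ℕ) (i : Fin n) :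
    ∑ j, PhiGenAux (fun k => Matrix.diagonal (lam k) * W k) τ (m + 1) i j =
      lam (τ + m) i * ∑ l, W (τ + m) i l *
        ∑ j, PhiGenAux (fun k => Matrix.diagonal (lam k) * W k) τ m l j := by
  simp only [PhiGenAux, Matrix.mul_apply (M := Matrix.diagonal (lam (τ + m)) * W (τ + m)),
    Matrix.diagonal_mul]
  rw [Finset.sum_comm]
  simp only [Finset.mul_sum, mul_assoc]

theorem sum_PhiGenAux_nonneg (hW0 : ∀ t i j, 0 ≤ W t i j)
    (hlam : ∀ t i, 0 ≤ lam t i ∧ lam t i ≤ 1) (τ m : ℕ) (i : Fin n) :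
    0 ≤ ∑ j, PhiGenAux (fun k => Matrix.diagonal (lam k) * W k) τ m i j :=
  Finset.sum_nonneg fun j _ => PhiGenAux_nonneg hW0 hlam τ m i j

theorem sum_PhiGenAux_le_one (hW0 : ∀ t i j, 0 ≤ W t i j) (hW1 : ∀ t i, ∑ j, W t i j = 1)
    (hlam : ∀ t i, 0 ≤ lam t i ∧ lam t i ≤ 1) (τ m : ℕ) (i : Fin n) :
    ∑ j, PhiGenAux (fun k => Matrix.diagonal (lam k) * W k) τ m i j ≤ 1 := by
  induction m generalizing i with
  | zero => simp [PhiGenAux, Matrix.one_apply]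
  | succ m ih =>
    rw [sum_PhiGenAux_succ]
    refine mul_le_one₀ (hlam _ _).2 (Finset.sum_nonneg fun l _ =>
      mul_nonneg (hW0 _ _ _) (sum_PhiGenAux_nonneg hW0 hlam τ m l)) ?_
    rw [← hW1 (τ + m) i]
    exact Finset.sum_le_sum fun l _ => mul_le_of_le_one_right (hW0 _ _ _) (ih l)

theorem sum_PhiGenAux_succ_le_lam (hW0 : ∀ t i j, 0 ≤ W t i j)
    (hW1 : ∀ t i, ∑ j, W t i j = 1) (hlam : ∀ t i, 0 ≤ lam t i ∧ lam t i ≤ 1)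
    (τ m : ℕ) (i : Fin n) :
    ∑ j, PhiGenAux (fun k => Matrix.diagonal (lam k) * W k) τ (m + 1) i j ≤
      lam (τ + m) i := by
  rw [sum_PhiGenAux_succ]
  refine mul_le_of_le_one_right (hlam _ _).1 ?_
  rw [← hW1 (τ + m) i]
  exact Finset.sum_le_sum fun l _ =>
    mul_le_of_le_one_right (hW0 _ _ _) (sum_PhiGenAux_le_one hW0 hW1 hlam τ m l)

/-- The row-sum deficit propagates along an edge, scaled by the edge weight. -/
theorem mul_deficit_le_deficit_succ (hW0 : ∀ t i j, 0 ≤ W t i j)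
    (hW1 : ∀ t i, ∑ j, W t i j = 1) (hlam : ∀ t i, 0 ≤ lam t i ∧ lam t i ≤ 1)
    (τ m : ℕ) (i l : Fin n) :
    W (τ + m) i l *
        (1 - ∑ j, PhiGenAux (fun k => Matrix.diagonal (lam k) * W k) τ m l j) ≤
      1 - ∑ j, PhiGenAux (fun k => Matrix.diagonal (lam k) * W k) τ (m + 1) i j := by
  rw [sum_PhiGenAux_succ]
  set x : Fin n → ℝ :=
    fun l => ∑ j, PhiGenAux (fun k => Matrix.diagonal (lam k) * W k) τ m l j with hx
  have hx0 : ∀ l, 0 ≤ x l := sum_PhiGenAux_nonneg hW0 hlam τ m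
  have hx1 : ∀ l, x l ≤ 1 := sum_PhiGenAux_le_one hW0 hW1 hlam τ m
  have hle : W (τ + m) i l * (1 - x l) ≤ ∑ l, W (τ + m) i l * (1 - x l) :=
    Finset.single_le_sum (f := fun l => W (τ + m) i l * (1 - x l))
      (fun l _ => mul_nonneg (hW0 _ _ _) (sub_nonneg.2 (hx1 l))) (Finset.mem_univ l)
  have hsum : ∑ l, W (τ + m) i l * (1 - x l) = 1 - ∑ l, W (τ + m) i l * x l := by
    simp only [mul_sub, mul_one, Finset.sum_sub_distrib, hW1]
  have hlamle : lam (τ + m) i * ∑ l, W (τ + m) i l * x l ≤ ∑ l, W (τ + m) i l * x l :=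
    mul_le_of_le_one_left (Finset.sum_nonneg fun l _ => mul_nonneg (hW0 _ _ _) (hx0 l))
      (hlam _ _).2
  exact hle.trans (hsum.le.trans (sub_le_sub_left hlamle 1))

theorem rowNorm_PhiGenAux_le_of_forall_sum_le (hn : 1 ≤ n) (hW0 : ∀ t i j, 0 ≤ W t i j)
    (hlam : ∀ t i, 0 ≤ lam t i ∧ lam t i ≤ 1) {τ m : ℕ} {c : ℝ}
    (h : ∀ i, ∑ j, PhiGenAux (fun k => Matrix.diagonal (lam k) * W k) τ m i j ≤ c) :
    rowNorm (PhiGenAux (fun k => Matrix.diagonal (lam k) * W k) τ m) ≤ c := by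
  refine rowNorm_le_of_forall hn fun i => ?_
  simpa only [abs_of_nonneg (PhiGenAux_nonneg hW0 hlam τ m i _)] using h i

/-- The nominal transition matrix contracts over a defected interval. -/
theorem rowNorm_PhiGenAux_le_of_isDefected (hn : 1 ≤ n) (hW0 : ∀ t i j, 0 ≤ W t i j)
    (hW1 : ∀ t i, ∑ j, W t i j = 1) (hlam : ∀ t i, 0 ≤ lam t i ∧ lam t i ≤ 1)
    {ε w : ℝ} (hε : 0 ≤ ε) (hw0 : 0 ≤ w) (hw1 : w ≤ 1) {t p : ℕ}
    (hdef : IsDefected lam W ε w t (t + p)) :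
    rowNorm (PhiGenAux (fun k => Matrix.diagonal (lam k) * W k) t p) ≤ 1 - ε * w ^ p := by
  refine rowNorm_PhiGenAux_le_of_forall_sum_le hn hW0 hlam fun i => ?_
  obtain ⟨s, hts, hsp, a, rfl, hsrc, hpath⟩ := hdef i
  obtain ⟨q, rfl⟩ := Nat.exists_eq_add_of_le hts
  have hdeficit : ∀ r, q + 1 + r ≤ p → ε * w ^ r ≤
      1 - ∑ j, PhiGenAux (fun k => Matrix.diagonal (lam k) * W k) t (q + 1 + r)
        (a (t + (q + 1 + r))) j := by
    intro r
    induction r with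
    | zero =>
      intro _
      have := sum_PhiGenAux_succ_le_lam hW0 hW1 hlam t q (a (t + (q + 1)))
      simp only [Nat.add_zero, pow_zero, mul_one]
      rw [Nat.add_assoc] at hsrc
      linarith
    | succ r ih =>
      intro hr
      have hwt := hpath (t + (q + 1 + r)) (by omega) (by omega)
      have ih := ih (by omega)
      refine le_trans ?_ (mul_deficit_le_deficit_succ hW0 hW1 hlam t (q + 1 + r)
        (a (t + (q + 1 + (r + 1)))) (a (t + (q + 1 + r))))
      calc ε * w ^ (r + 1) = w * (ε * w ^ r) := by ring
        _ ≤ _ := mul_le_mul hwt ih (by positivity) (hW0 _ _ _)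
  obtain ⟨r, rfl⟩ := Nat.exists_eq_add_of_le (show q + 1 ≤ p by omega)
  have hpow : ε * w ^ (q + 1 + r) ≤ ε * w ^ r :=
    mul_le_mul_of_nonneg_left (pow_le_pow_of_le_one hw0 hw1 (by omega)) hε
  linarith [hdeficit r le_rfl]

/-- A system that contracts by `γ ^ p` over every window of length `p`, and is nonexpansive,
is exponentially bounded with rate `γ`. -/
theorem rowNorm_PhiGenAux_le_of_window {A : ℕ → Matrix (Fin n) (Fin n) ℝ} {γ : ℝ} {p : ℕ}
    (hp : 1 ≤ p) (hγ0 : 0 < γ) (hγ1 : γ ≤ 1) (hone : ∀ τ m, rowNorm (PhiGenAux A τ m) ≤ 1)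
    (hwin : ∀ τ, rowNorm (PhiGenAux A τ p) ≤ γ ^ p) (τ m : ℕ) :
    rowNorm (PhiGenAux A τ m) ≤ (γ ^ p)⁻¹ * γ ^ m := by
  induction m using Nat.strong_induction_on generalizing τ with
  | _ m ih =>
    rcases lt_or_ge m p with hm | hm
    · refine (hone τ m).trans ?_
      rw [← div_eq_inv_mul, one_le_div (by positivity)]
      exact pow_le_pow_of_le_one hγ0.le hγ1 hm.le
    · obtain ⟨r, rfl⟩ := Nat.exists_eq_add_of_le hm
      rw [PhiGenAux_add]
      calc _ ≤ ((γ ^ p)⁻¹ * γ ^ r) * γ ^ p :=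
            (rowNorm_mul_le _ _).trans (mul_le_mul (ih r (by omega) _) (hwin τ)
              (rowNorm_nonneg _) (by positivity))
        _ = _ := by ring

end Defected

/-- The smallness condition on `ζ` keeps the perturbed rate below one. -/
theorem rpow_inv_add_inv_mul_lt_one {δ ζ : ℝ} {p : ℕ} (hδ0 : 0 < δ) (hδ1 : δ < 1) (hp : 1 ≤ p)
    (hζ : ζ < -(1 / (p : ℝ)) * δ ^ ((p : ℝ) + ((p : ℝ))⁻¹) * Real.log δ) :
    δ ^ ((p : ℝ))⁻¹ + δ⁻¹ * ζ < 1 := by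
  set γ := δ ^ ((p : ℝ))⁻¹ with hγ
  have hγ0 : 0 < γ := Real.rpow_pos_of_pos hδ0 _
  have hγ1 : γ ≤ 1 := Real.rpow_le_one hδ0.le hδ1.le (by positivity)
  have hlog : Real.log γ = ((p : ℝ))⁻¹ * Real.log δ := Real.log_rpow hδ0 _
  rw [Real.rpow_add hδ0, Real.rpow_natCast, ← hγ,
    show -(1 / (p : ℝ)) * (δ ^ p * γ) * Real.log δ = δ ^ p * (γ * -Real.log γ) by
      rw [hlog, one_div]; ring] at hζ
  have hbound : γ * -Real.log γ ≤ 1 - γ := by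
    have h := mul_le_mul_of_nonneg_left (Real.one_sub_inv_le_log_of_pos hγ0) hγ0.le
    rw [mul_sub, mul_inv_cancel₀ hγ0.ne'] at h
    linarith
  have hpow : δ ^ p ≤ δ := pow_le_of_le_one hδ0.le hδ1.le (by omega)
  have hζ' : ζ < δ * (1 - γ) := hζ.trans_le
    ((mul_le_mul_of_nonneg_left hbound (by positivity)).trans
      (mul_le_mul_of_nonneg_right hpow (by linarith)))
  have := (inv_mul_lt_iff₀ hδ0).2 hζ'
  linarith

/-- robustness of exponential stability for perturbed
semi-periodic defected networks: if every interval `[t, t+p)` is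
`(ε,w)`-defected for the nominal data and the perturbation satisfies
`‖E(t)‖ ≤ ζ < −(1/p)(1−εw^p)^{p+1/p} ln(1−εw^p)`, then the perturbed
transition matrices are exponentially stable. -/
theorem perturbed_spfj_exponential_stability {n : ℕ} (hn : 1 ≤ n)
    (lam : ℕ → Fin n → ℝ) (Wb : ℕ → Matrix (Fin n) (Fin n) ℝ)
    (hW0 : ∀ t i j, 0 ≤ Wb t i j) (hW1 : ∀ t i, ∑ j, Wb t i j = 1)
    (hlam : ∀ t i, 0 ≤ lam t i ∧ lam t i ≤ 1)
    (ε w : ℝ) (hε : 0 < ε ∧ ε < 1) (hw : 0 < w ∧ w < 1)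
    (p : ℕ) (hp : 1 ≤ p)
    (hdef : ∀ t : ℕ, IsDefected lam Wb ε w t (t + p))
    (E : ℕ → Matrix (Fin n) (Fin n) ℝ) (ζ : ℝ)
    (hE : ∀ t, rowNorm (E t) ≤ ζ)
    (hζ : ζ < -(1 / (p : ℝ)) * (1 - ε * w ^ p) ^ ((p : ℝ) + ((p : ℝ))⁻¹) *
      Real.log (1 - ε * w ^ p)) :
    ∃ c' γ' : ℝ, 0 < c' ∧ 0 < γ' ∧ γ' < 1 ∧
      ∀ τ t : ℕ, τ ≤ t →
        rowNorm (PhiGen (fun k => Matrix.diagonal (lam k) * Wb k + E k) t τ) ≤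
          c' * γ' ^ (t - τ) := by
  set δ := 1 - ε * w ^ p with hδ
  have hwp0 : 0 < w ^ p := pow_pos hw.1 p
  have hwp1 : w ^ p ≤ 1 := pow_le_one₀ hw.1.le hw.2.le
  have hδ0 : 0 < δ := by nlinarith [hε.1, hε.2]
  have hδ1 : δ < 1 := by nlinarith [hε.1]
  have hζ0 : 0 ≤ ζ := (rowNorm_nonneg _).trans (hE 0)
  have hγ0 : 0 < δ ^ ((p : ℝ))⁻¹ := Real.rpow_pos_of_pos hδ0 _
  have hγ1 : δ ^ ((p : ℝ))⁻¹ ≤ 1 := Real.rpow_le_one hδ0.le hδ1.le (by positivity)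
  have hγp : (δ ^ ((p : ℝ))⁻¹) ^ p = δ := Real.rpow_inv_natCast_pow hδ0.le (by omega)
  have hnominal : ∀ τ m, rowNorm (PhiGenAux (fun k => Matrix.diagonal (lam k) * Wb k) τ m) ≤
      δ⁻¹ * (δ ^ ((p : ℝ))⁻¹) ^ m := by
    intro τ m
    have h := rowNorm_PhiGenAux_le_of_window hp hγ0 hγ1
      (fun τ m => rowNorm_PhiGenAux_le_of_forall_sum_le hn hW0 hlam
        (sum_PhiGenAux_le_one hW0 hW1 hlam τ m))
      (fun τ => (rowNorm_PhiGenAux_le_of_isDefected hn hW0 hW1 hlam hε.1.le hw.1.le hw.2.le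
        (hdef τ)).trans_eq hγp.symm) τ m
    rwa [hγp] at h
  exact ⟨δ⁻¹, δ ^ ((p : ℝ))⁻¹ + δ⁻¹ * ζ, inv_pos.2 hδ0, by positivity,
    rpow_inv_add_inv_mul_lt_one hδ0 hδ1 hp hζ, fun τ t _ =>
      rowNorm_PhiGenAux_perturbation_le (inv_pos.2 hδ0).le hγ0.le hζ0 hnominal hE τ (t - τ)⟩
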